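/- Fix d ≥ 1, T > 0, a compact interval Θ = [θ_min, θ_max] ⊂ (0,∞), a link function Φ, and a smooth ℤ^d-periodic initial value u_0. There exists a constant D > 0, depending only on d, T, Θ, Φ and u_0, such that: for all θ, θ₀ ∈ Θ and every continuous ℤ^d-periodic F : ℝ^d → ℝ that is bounded, if u_{θ,F} and u_{θ₀,F} are smooth classical solutions with absorption Φ∘F, initial value u_0 and diffusivities θ and θ₀ respectively, then ‖u_{θ,F} − u_{θ₀,F}‖_{H^{2,1}(Q)} ≤ D |θ − θ₀| (1 + ‖F‖_{L²(𝕋^d)})(1 + ‖F‖_∞). (Lemma 'bounds', item (iii): Lipschitz continuity of the forward map in the diffusivity θ.) -/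

import Mathlib

open MeasureTheory Real Filter

noncomputable section

/-- Partial derivative in the `i`-th spatial coordinate. -/
def pder {d : ℕ} (i : Fin d) (v : (Fin d → ℝ) → ℝ) : (Fin d → ℝ) → ℝ :=
  fun x => deriv (fun s => v (Function.update x i s)) (x i)

/-- Spatial Laplacian `Δ_x = ∑ᵢ ∂²/∂xᵢ²`. -/
def lap {d : ℕ} (v : (Fin d → ℝ) → ℝ) : (Fin d → ℝ) → ℝ :=
  fun x => ∑ i : Fin d, pder i (pder i v) x

/-- Multi-index spatial derivative `∂^j`. -/
def mder {d : ℕ} (j : Fin d → ℕ) (v : (Fin d → ℝ) → ℝ) : (Fin d → ℝ) → ℝ :=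
  (List.finRange d).foldr (fun i acc => (pder i)^[j i] acc) v

/-- `ℤ^d`-periodicity of a function on `ℝ^d`. -/
def ZPer {d : ℕ} (F : (Fin d → ℝ) → ℝ) : Prop :=
  ∀ (x : Fin d → ℝ) (k : Fin d → ℤ), F (fun i => x i + (k i : ℝ)) = F x

/-- `ℤ^d`-periodicity in the space variable. -/
def ZPerSpace {d : ℕ} (u : (Fin d → ℝ) → ℝ → ℝ) : Prop :=
  ∀ t : ℝ, ZPer fun x => u x t

/-- The fundamental domain `[0,1]^d` of the torus. -/
def unitCube (d : ℕ) : Set (Fin d → ℝ) := Set.Icc 0 1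

/-- `L²`-norm on the torus. -/
def l2T {d : ℕ} (F : (Fin d → ℝ) → ℝ) : ℝ :=
  Real.sqrt (∫ x in unitCube d, (F x) ^ 2)

/-- `L²`-norm on `Q = 𝕋^d × (0,T)`. -/
def l2Q {d : ℕ} (T : ℝ) (u : (Fin d → ℝ) → ℝ → ℝ) : ℝ :=
  Real.sqrt (∫ t in Set.Ioc (0 : ℝ) T, ∫ x in unitCube d, (u x t) ^ 2)

/-- Supremum norm over space. -/
def supT {d : ℕ} (F : (Fin d → ℝ) → ℝ) : ℝ := ⨆ x, |F x|

/-- Supremum norm over `𝕋^d × [0,T]`. -/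
def supQ {d : ℕ} (T : ℝ) (u : (Fin d → ℝ) → ℝ → ℝ) : ℝ :=
  ⨆ x, ⨆ t ∈ Set.Icc (0 : ℝ) T, |u x t|

/-- Squared Sobolev `H^β`-norm on the torus:  `∑_{|j| ≤ β} ‖∂^j F‖²_{L²(𝕋^d)}`. -/
def hSobSq {d : ℕ} (β : ℕ) (F : (Fin d → ℝ) → ℝ) : ℝ :=
  ∑ j ∈ Finset.univ.filter (fun j : Fin d → Fin (β + 1) => (∑ i, (j i : ℕ)) ≤ β),
    ∫ x in unitCube d, (mder (fun i => (j i : ℕ)) F x) ^ 2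

/-- Sobolev `H^β`-norm on the torus. -/
def hSob {d : ℕ} (β : ℕ) (F : (Fin d → ℝ) → ℝ) : ℝ := Real.sqrt (hSobSq β F)

/-- Squared parabolic Sobolev `H^{2,1}(Q)`-norm. -/
def h21Sq {d : ℕ} (T : ℝ) (u : (Fin d → ℝ) → ℝ → ℝ) : ℝ :=
  (∫ t in Set.Ioc (0 : ℝ) T,
      ∑ j ∈ Finset.univ.filter (fun j : Fin d → Fin 3 => (∑ i, (j i : ℕ)) ≤ 2),
        ∫ x in unitCube d, (mder (fun i => (j i : ℕ)) (fun y => u y t) x) ^ 2)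
    + ∫ x in unitCube d, ∫ t in Set.Ioc (0 : ℝ) T, ((u x t) ^ 2 + (deriv (u x) t) ^ 2)

/-- Parabolic Sobolev `H^{2,1}(Q)`-norm. -/
def h21 {d : ℕ} (T : ℝ) (u : (Fin d → ℝ) → ℝ → ℝ) : ℝ := Real.sqrt (h21Sq T u)

/-- Smoothness of a function of space and time. -/
def SmoothQ {d : ℕ} (u : (Fin d → ℝ) → ℝ → ℝ) : Prop :=
  ContDiff ℝ (⊤ : ℕ∞) fun p : (Fin d → ℝ) × ℝ => u p.1 p.2

/-- A smooth classical solution of the heat equation with absorption `f`,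
diffusivity `θ` and initial value `u0`. -/
def HeatSol {d : ℕ} (T θ : ℝ) (f u0 : (Fin d → ℝ) → ℝ) (u : (Fin d → ℝ) → ℝ → ℝ) : Prop :=
  SmoothQ u ∧ ZPerSpace u ∧
    (∀ (x : Fin d → ℝ), ∀ t ∈ Set.Ioc (0 : ℝ) T,
      deriv (u x) t = θ / 2 * lap (fun y => u y t) x - f x * u x t) ∧
    ∀ x, u x 0 = u0 x

/-- A smooth solution of the inhomogeneous problem with forcing `g` and
zero initial value (`v = 𝓛_{θ,f}⁻¹ g`). -/
def InhomSol {d : ℕ} (T θ : ℝ) (f : (Fin d → ℝ) → ℝ) (g v : (Fin d → ℝ) → ℝ → ℝ) : Prop :=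
  SmoothQ v ∧ ZPerSpace v ∧
    (∀ (x : Fin d → ℝ), ∀ t ∈ Set.Ioc (0 : ℝ) T,
      deriv (v x) t = θ / 2 * lap (fun y => v y t) x - f x * v x t + g x t) ∧
    ∀ x, v x 0 = 0

/-- A link function: a smooth function `Φ : ℝ → (fmin, ∞)` with strictly positive
derivative and all derivatives bounded. -/
structure LinkFun where
  toFun : ℝ → ℝ
  fmin : ℝ
  fmin_pos : 0 < fmin
  smooth : ContDiff ℝ (⊤ : ℕ∞) toFun
  gt_fmin : ∀ x, fmin < toFun x
  deriv_pos : ∀ x, 0 < deriv toFun x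
  derivs_bdd : ∀ n : ℕ, 1 ≤ n → ∃ C, ∀ x, |iteratedDeriv n toFun x| ≤ C

/-- The linearized solution `I_{θ,F} h` in direction `h`, associated with a solution `u`. -/
def LinSol {d : ℕ} (T θ : ℝ) (Φ : LinkFun) (F h : (Fin d → ℝ) → ℝ)
    (u z : (Fin d → ℝ) → ℝ → ℝ) : Prop :=
  SmoothQ z ∧ ZPerSpace z ∧
    (∀ (x : Fin d → ℝ), ∀ t ∈ Set.Ioc (0 : ℝ) T,
      deriv (z x) t = θ / 2 * lap (fun y => z y t) x - Φ.toFun (F x) * z x t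
        + h x * deriv Φ.toFun (F x) * u x t) ∧
    ∀ x, z x 0 = 0

/-- The `θ`-derivative solution `K̇_θ F`, associated with a solution `u`. -/
def ThetaDerivSol {d : ℕ} (T θ : ℝ) (Φ : LinkFun) (F : (Fin d → ℝ) → ℝ)
    (u w : (Fin d → ℝ) → ℝ → ℝ) : Prop :=
  SmoothQ w ∧ ZPerSpace w ∧
    (∀ (x : Fin d → ℝ), ∀ t ∈ Set.Ioc (0 : ℝ) T,
      deriv (w x) t = θ / 2 * lap (fun y => w y t) x - Φ.toFun (F x) * w x t
        + 1 / 2 * lap (fun y => u y t) x) ∧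
    ∀ x, w x 0 = 0

/-- Dual Sobolev norm `‖G‖_{(H²)*}` on the torus. -/
def h2dual {d : ℕ} (G : (Fin d → ℝ) → ℝ) : ℝ :=
  sSup {r : ℝ | ∃ g : (Fin d → ℝ) → ℝ, ContDiff ℝ (⊤ : ℕ∞) g ∧ ZPer g ∧ hSob 2 g ≤ 1 ∧
    r = |∫ x in unitCube d, G x * g x|}

end

/-- Smooth functions on space-time that are `ℤ^d`-periodic in the space variable. -/
structure SmoothPer {d : ℕ} (U : (Fin d → ℝ) × ℝ → ℝ) : Prop where
  smooth : ContDiff ℝ (⊤ : ℕ∞) U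
  periodic : ∀ (x : Fin d → ℝ) (t : ℝ) (k : Fin d → ℤ), U (fun i => x i + (k i : ℝ), t) = U (x, t)

/-- The derivative in the fixed direction `v`. -/
noncomputable def dirDeriv {E : Type*} [NormedAddCommGroup E] [NormedSpace ℝ E]
    (v : E) (U : E → ℝ) : E → ℝ :=
  fun p => fderiv ℝ U p v

/-- The `i`-th spatial unit vector of space-time. -/
noncomputable def spaceDir {d : ℕ} (i : Fin d) : (Fin d → ℝ) × ℝ := (Pi.single i 1, 0)

/-- The temporal unit vector of space-time. -/
noncomputable def timeDir (d : ℕ) : (Fin d → ℝ) × ℝ := (0, 1)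

/-- The spatial Laplacian of a function on space-time. -/
noncomputable def spaceLap {d : ℕ} (U : (Fin d → ℝ) × ℝ → ℝ) : (Fin d → ℝ) × ℝ → ℝ :=
  fun p => ∑ i, dirDeriv (spaceDir i) (dirDeriv (spaceDir i) U) p

/-- Lebesgue measure on the space-time cylinder `[0,1]^d × (0,T]`. -/
noncomputable def cylMeasure (d : ℕ) (T : ℝ) : Measure ((Fin d → ℝ) × ℝ) :=
  volume.restrict (unitCube d ×ˢ Set.Ioc (0 : ℝ) T)

section DirectionalDerivative

variable {E : Type*} [NormedAddCommGroup E] [NormedSpace ℝ E]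

lemma ContDiff.dirDeriv {U : E → ℝ} (hU : ContDiff ℝ (⊤ : ℕ∞) U) (v : E) :
    ContDiff ℝ (⊤ : ℕ∞) (dirDeriv v U) :=
  (hU.fderiv_right (m := (⊤ : ℕ∞)) (by simp)).clm_apply contDiff_const

lemma dirDeriv_comm {U : E → ℝ} (hU : ContDiff ℝ (⊤ : ℕ∞) U) (v w : E) :
    dirDeriv v (dirDeriv w U) = dirDeriv w (dirDeriv v U) := by
  have hd : Differentiable ℝ (fderiv ℝ U) :=
    (hU.fderiv_right (m := (⊤ : ℕ∞)) (by simp)).differentiable (by simp)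
  have key : ∀ (a b : E) (p : E),
      dirDeriv a (dirDeriv b U) p = fderiv ℝ (fderiv ℝ U) p a b := by
    intro a b p
    unfold dirDeriv
    rw [fderiv_clm_apply (hd p) (by fun_prop)]
    simp
  ext p
  rw [key, key]
  have h2 : minSmoothness ℝ 2 ≤ ((⊤ : ℕ∞) : WithTop ℕ∞) := by
    simpa using WithTop.coe_le_coe.2 (le_top (a := (2 : ℕ∞)))
  exact (hU.contDiffAt.isSymmSndFDerivAt h2).eq v w

lemma dirDeriv_mul {A B : E → ℝ} (hA : ContDiff ℝ (⊤ : ℕ∞) A) (hB : ContDiff ℝ (⊤ : ℕ∞) B)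
    (v p : E) :
    dirDeriv v (fun q => A q * B q) p = A p * dirDeriv v B p + dirDeriv v A p * B p := by
  unfold dirDeriv
  rw [fderiv_fun_mul (hA.differentiable (by simp) p) (hB.differentiable (by simp) p)]
  simp
  ring

lemma dirDeriv_sub {A B : E → ℝ} (hA : ContDiff ℝ (⊤ : ℕ∞) A) (hB : ContDiff ℝ (⊤ : ℕ∞) B)
    (v : E) :
    dirDeriv v (fun q => A q - B q) = fun p => dirDeriv v A p - dirDeriv v B p := by
  ext p
  unfold dirDeriv
  rw [fderiv_fun_sub (hA.differentiable (by simp) p) (hB.differentiable (by simp) p)]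
  simp

end DirectionalDerivative

namespace SmoothPer

variable {d : ℕ} {U A B : (Fin d → ℝ) × ℝ → ℝ}

lemma dirDeriv (hU : SmoothPer U) (v : (Fin d → ℝ) × ℝ) : SmoothPer (dirDeriv v U) where
  smooth := hU.smooth.dirDeriv v
  periodic x t k := by
    have h : (fun p => U (p + ((fun i => (k i : ℝ)), 0))) = U := by
      ext ⟨y, s⟩
      simpa using! hU.periodic y s k
    have h2 := fderiv_comp_add_right (𝕜 := ℝ) (f := U) (x := (x, t))
      ((fun i => (k i : ℝ)), (0 : ℝ))
    rw [h] at h2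
    unfold _root_.dirDeriv
    rw [h2]
    congr 2
    simp
    rfl

lemma mul (hA : SmoothPer A) (hB : SmoothPer B) : SmoothPer (fun p => A p * B p) where
  smooth := hA.smooth.mul hB.smooth
  periodic x t k := by simp only [hA.periodic, hB.periodic]

lemma sub (hA : SmoothPer A) (hB : SmoothPer B) : SmoothPer (fun p => A p - B p) where
  smooth := hA.smooth.sub hB.smooth
  periodic x t k := by simp only [hA.periodic, hB.periodic]

lemma continuous (hU : SmoothPer U) : Continuous U := hU.smooth.continuous

lemma continuous_spaceLap (hU : SmoothPer U) : Continuous (spaceLap U) :=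
  continuous_finsetSum _ fun _ _ => ((hU.dirDeriv _).dirDeriv _).continuous

end SmoothPer

lemma spaceLap_sub {d : ℕ} {A B : (Fin d → ℝ) × ℝ → ℝ} (hA : SmoothPer A) (hB : SmoothPer B) :
    spaceLap (fun p => A p - B p) = fun p => spaceLap A p - spaceLap B p := by
  ext p
  simp only [spaceLap]
  rw [← Finset.sum_sub_distrib]
  refine Finset.sum_congr rfl fun i _ => ?_
  rw [dirDeriv_sub hA.smooth hB.smooth,
    dirDeriv_sub (hA.dirDeriv _).smooth (hB.dirDeriv _).smooth]

section Coordinates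

variable {d : ℕ} {U : (Fin d → ℝ) × ℝ → ℝ}

lemma hasDerivAt_update_slice (hU : Differentiable ℝ U) (i : Fin d) (x : Fin d → ℝ) (t s : ℝ) :
    HasDerivAt (fun s => U (Function.update x i s, t))
      (dirDeriv (spaceDir i) U (Function.update x i s, t)) s := by
  have h1 : HasDerivAt (fun s => (Function.update x i s, t)) (spaceDir i) s :=
    (hasDerivAt_update x i s).prodMk (hasDerivAt_const s t)
  exact (hU _).hasFDerivAt.comp_hasDerivAt s h1

lemma pder_slice (hU : ContDiff ℝ (⊤ : ℕ∞) U) (i : Fin d) (t : ℝ) :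
    pder i (fun y => U (y, t)) = fun x => dirDeriv (spaceDir i) U (x, t) := by
  ext x
  have := (hasDerivAt_update_slice (hU.differentiable (by simp)) i x t (x i)).deriv
  simpa [pder] using this

lemma lap_slice (hU : ContDiff ℝ (⊤ : ℕ∞) U) (t : ℝ) :
    lap (fun y => U (y, t)) = fun x => spaceLap U (x, t) := by
  ext x
  simp only [lap, spaceLap]
  refine Finset.sum_congr rfl fun i _ => ?_
  rw [pder_slice hU, pder_slice (hU.dirDeriv _)]

lemma hasDerivAt_time_slice (hU : ContDiff ℝ (⊤ : ℕ∞) U) (x : Fin d → ℝ) (t : ℝ) :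
    HasDerivAt (fun s => U (x, s)) (dirDeriv (timeDir d) U (x, t)) t := by
  have h1 : HasDerivAt (fun s : ℝ => (x, s)) (timeDir d) t :=
    (hasDerivAt_const t x).prodMk (hasDerivAt_id t)
  exact ((hU.differentiable (by simp)) _).hasFDerivAt.comp_hasDerivAt t h1

/-- Iterated spatial derivatives of a function on space-time along a list of indices. -/
noncomputable def listDeriv (L : List (Fin d)) (U : (Fin d → ℝ) × ℝ → ℝ) : (Fin d → ℝ) × ℝ → ℝ :=
  L.foldr (fun i V => dirDeriv (spaceDir i) V) U

lemma contDiff_listDeriv (hU : ContDiff ℝ (⊤ : ℕ∞) U) (L : List (Fin d)) :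
    ContDiff ℝ (⊤ : ℕ∞) (listDeriv L U) := by
  induction L with
  | nil => exact hU
  | cons i L ih => exact ih.dirDeriv _

lemma foldr_pder_slice (hU : ContDiff ℝ (⊤ : ℕ∞) U) (L : List (Fin d)) (t : ℝ) :
    L.foldr pder (fun y => U (y, t)) = fun x => listDeriv L U (x, t) := by
  induction L with
  | nil => rfl
  | cons i L ih =>
    rw [List.foldr_cons, ih, pder_slice (contDiff_listDeriv hU L)]
    rfl

lemma exists_mder_eq_foldr (j : Fin d → ℕ) :
    ∃ L : List (Fin d), L.length = ∑ i, j i ∧ ∀ v : (Fin d → ℝ) → ℝ, mder j v = L.foldr pder v := by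
  have key : ∀ l : List (Fin d), ∃ L : List (Fin d), L.length = (l.map j).sum ∧
      ∀ v : (Fin d → ℝ) → ℝ,
        l.foldr (fun i acc => (pder i)^[j i] acc) v = L.foldr pder v := by
    intro l
    induction l with
    | nil => exact ⟨[], rfl, fun v => rfl⟩
    | cons i l ih =>
      obtain ⟨L, hL, hv⟩ := ih
      refine ⟨List.replicate (j i) i ++ L, by simp [hL], fun v => ?_⟩
      rw [List.foldr_cons, hv, List.foldr_append]
      generalize L.foldr pder v = w
      induction j i with
      | zero => rfl
      | succ n ihn => rw [Function.iterate_succ_apply', ihn, List.replicate_succ, List.foldr_cons]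
  obtain ⟨L, hL, hv⟩ := key (List.finRange d)
  refine ⟨L, ?_, hv⟩
  rw [hL]
  simp [Fin.univ_def, Finset.sum]

end Coordinates

section Integration

variable {d : ℕ} {T : ℝ} {U A B : (Fin d → ℝ) × ℝ → ℝ}

lemma cylMeasure_eq_prod (d : ℕ) (T : ℝ) :
    cylMeasure d T
      = (volume.restrict (unitCube d)).prod (volume.restrict (Set.Ioc (0 : ℝ) T)) := by
  rw [cylMeasure, Measure.prod_restrict, Measure.volume_eq_prod]

lemma integrable_cylMeasure {g : (Fin d → ℝ) × ℝ → ℝ} (hg : Continuous g) :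
    Integrable g (cylMeasure d T) := by
  have h : IntegrableOn g (unitCube d ×ˢ Set.Icc (0 : ℝ) T) :=
    hg.continuousOn.integrableOn_compact (isCompact_Icc.prod isCompact_Icc)
  exact h.mono_set (Set.prod_mono subset_rfl Set.Ioc_subset_Icc_self)

lemma integrableOn_unitCube {g : (Fin d → ℝ) → ℝ} (hg : Continuous g) :
    IntegrableOn g (unitCube d) :=
  hg.continuousOn.integrableOn_compact isCompact_Icc

lemma ae_cylMeasure {P : (Fin d → ℝ) × ℝ → Prop}
    (h : ∀ x, ∀ t ∈ Set.Ioc (0 : ℝ) T, P (x, t)) : ∀ᵐ p ∂cylMeasure d T, P p := by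
  have hm : MeasurableSet (unitCube d ×ˢ Set.Ioc (0 : ℝ) T) :=
    measurableSet_Icc.prod measurableSet_Ioc
  filter_upwards [ae_restrict_mem hm] with p hp
  exact h p.1 p.2 hp.2

lemma integral_cylMeasure {g : (Fin d → ℝ) × ℝ → ℝ} (hg : Continuous g) :
    ∫ p, g p ∂cylMeasure d T = ∫ x in unitCube d, ∫ t in Set.Ioc (0 : ℝ) T, g (x, t) := by
  have h := integrable_cylMeasure (T := T) hg
  rw [cylMeasure_eq_prod] at h ⊢
  exact integral_prod _ h

lemma integral_cylMeasure_symm {g : (Fin d → ℝ) × ℝ → ℝ} (hg : Continuous g) :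
    ∫ p, g p ∂cylMeasure d T = ∫ t in Set.Ioc (0 : ℝ) T, ∫ x in unitCube d, g (x, t) := by
  have h := integrable_cylMeasure (T := T) hg
  rw [cylMeasure_eq_prod] at h ⊢
  exact integral_prod_symm _ h

lemma integrableOn_integral_unitCube {g : (Fin d → ℝ) × ℝ → ℝ} (hg : Continuous g) :
    IntegrableOn (fun t => ∫ x in unitCube d, g (x, t)) (Set.Ioc (0 : ℝ) T) := by
  have h := integrable_cylMeasure (T := T) hg
  rw [cylMeasure_eq_prod] at h
  exact h.integral_prod_right

lemma integral_unitCube_spaceDeriv (hU : SmoothPer U) (i : Fin d) (t : ℝ) :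
    ∫ x in unitCube d, dirDeriv (spaceDir i) U (x, t) = 0 := by
  obtain ⟨n, rfl⟩ : ∃ n, d = n + 1 := ⟨d - 1, by have := i.pos; omega⟩
  have hv : ∀ x, HasFDerivAt (fun y => U (y, t))
      ((fderiv ℝ U (x, t)).comp (ContinuousLinearMap.inl ℝ (Fin (n + 1) → ℝ) ℝ)) x := fun x =>
    ((hU.smooth.differentiable (by simp)) (x, t)).hasFDerivAt.comp x (hasFDerivAt_prodMk_left x t)
  have hcont : Continuous fun y => U (y, t) := hU.continuous.comp (by fun_prop)
  have hsum : ∀ x, ∑ k, (if k = i then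
      ((fderiv ℝ U (x, t)).comp (ContinuousLinearMap.inl ℝ (Fin (n + 1) → ℝ) ℝ)) else 0)
        (Pi.single k 1) = dirDeriv (spaceDir i) U (x, t) := by
    intro x
    rw [Finset.sum_eq_single i (by intro b _ hb; simp [hb]) (by simp)]
    simp [dirDeriv, spaceDir]
  have key := integral_divergence_of_hasFDerivAt_off_countable' (0 : Fin (n + 1) → ℝ) 1
    zero_le_one (fun k x => if k = i then U (x, t) else 0)
    (fun k x => if k = i then
      ((fderiv ℝ U (x, t)).comp (ContinuousLinearMap.inl ℝ (Fin (n + 1) → ℝ) ℝ)) else 0)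
    ∅ Set.countable_empty
    (by
      intro k
      by_cases hk : k = i
      · simpa [hk] using hcont.continuousOn
      · simpa [hk] using continuousOn_const)
    (by
      intro x _ k
      by_cases hk : k = i
      · simpa [hk] using hv x
      · simpa [hk] using hasFDerivAt_const (0 : ℝ) x)
    (by
      simp only [hsum]
      exact integrableOn_unitCube ((hU.dirDeriv _).continuous.comp (by fun_prop)))
  simp only [hsum] at key
  rw [unitCube, key]
  refine Finset.sum_eq_zero fun k _ => ?_
  by_cases hk : k = i
  · subst hk
    rw [sub_eq_zero]
    refine integral_congr_ae (Eventually.of_forall fun x => ?_)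
    simp only [if_true, Pi.one_apply, Pi.zero_apply]
    rw [← hU.periodic (Fin.insertNth k 0 x) t (Pi.single k 1)]
    congr 2
    ext m
    refine Fin.succAboveCases k ?_ (fun m => ?_) m
    · simp
    · simp
  · simp [hk]

lemma integral_spaceDeriv (hU : SmoothPer U) (i : Fin d) :
    ∫ p, dirDeriv (spaceDir i) U p ∂cylMeasure d T = 0 := by
  rw [integral_cylMeasure_symm (hU.dirDeriv _).continuous]
  simp [integral_unitCube_spaceDeriv hU]

lemma integral_mul_spaceDeriv (hA : SmoothPer A) (hB : SmoothPer B) (i : Fin d) :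
    ∫ p, A p * dirDeriv (spaceDir i) B p ∂cylMeasure d T
      = -∫ p, dirDeriv (spaceDir i) A p * B p ∂cylMeasure d T := by
  have h := integral_spaceDeriv (T := T) (hA.mul hB) i
  simp only [dirDeriv_mul hA.smooth hB.smooth] at h
  rw [integral_add] at h
  · linarith
  · exact integrable_cylMeasure (hA.continuous.mul (hB.dirDeriv _).continuous)
  · exact integrable_cylMeasure ((hA.dirDeriv _).continuous.mul hB.continuous)

lemma integral_timeDeriv (hT : 0 ≤ T) (hU : SmoothPer U) :
    ∫ p, dirDeriv (timeDir d) U p ∂cylMeasure d T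
      = (∫ x in unitCube d, U (x, T)) - ∫ x in unitCube d, U (x, 0) := by
  have hc : ∀ t : ℝ, Continuous fun x => U (x, t) := fun t => hU.continuous.comp (by fun_prop)
  rw [integral_cylMeasure (hU.dirDeriv _).continuous,
    ← integral_sub (integrableOn_unitCube (hc T)) (integrableOn_unitCube (hc 0))]
  refine integral_congr_ae (Eventually.of_forall fun x => ?_)
  simp only
  rw [← intervalIntegral.integral_of_le hT]
  refine intervalIntegral.integral_eq_sub_of_hasDerivAt
    (fun t _ => hasDerivAt_time_slice hU.smooth x t) ?_
  exact ((hU.dirDeriv _).continuous.comp (by fun_prop : Continuous fun t : ℝ => (x, t)))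
    |>.intervalIntegrable _ _

lemma integral_mul_timeDeriv_self (hT : 0 ≤ T) (hU : SmoothPer U) :
    ∫ p, U p * dirDeriv (timeDir d) U p ∂cylMeasure d T
      = ((∫ x in unitCube d, U (x, T) ^ 2) - ∫ x in unitCube d, U (x, 0) ^ 2) / 2 := by
  have h := integral_timeDeriv hT (hU.mul hU)
  have e : ∀ p, U p * dirDeriv (timeDir d) U p + dirDeriv (timeDir d) U p * U p
      = 2 * (U p * dirDeriv (timeDir d) U p) := fun p => by ring
  simp only [dirDeriv_mul hU.smooth hU.smooth, e] at h
  simp only [← pow_two] at h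
  rw [integral_const_mul] at h
  linarith

/-- The squared `L²`-norm on the space-time cylinder. -/
noncomputable def cylSq (T : ℝ) (U : (Fin d → ℝ) × ℝ → ℝ) : ℝ := ∫ p, U p ^ 2 ∂cylMeasure d T

/-- The squared `L²`-norm of the spatial gradient on the space-time cylinder. -/
noncomputable def gradSq (T : ℝ) (U : (Fin d → ℝ) × ℝ → ℝ) : ℝ :=
  ∑ i, cylSq T (dirDeriv (spaceDir i) U)

lemma cylSq_nonneg (T : ℝ) (U : (Fin d → ℝ) × ℝ → ℝ) : 0 ≤ cylSq T U :=
  integral_nonneg fun _ => sq_nonneg _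

lemma gradSq_nonneg (T : ℝ) (U : (Fin d → ℝ) × ℝ → ℝ) : 0 ≤ gradSq T U :=
  Finset.sum_nonneg fun _ _ => cylSq_nonneg T _

lemma integral_mul_spaceLap (hA : SmoothPer A) (hB : SmoothPer B) :
    ∫ p, A p * spaceLap B p ∂cylMeasure d T
      = -∑ i, ∫ p, dirDeriv (spaceDir i) A p * dirDeriv (spaceDir i) B p ∂cylMeasure d T := by
  simp only [spaceLap, Finset.mul_sum]
  rw [integral_finsetSum, ← Finset.sum_neg_distrib]
  · exact Finset.sum_congr rfl fun i _ => integral_mul_spaceDeriv hA (hB.dirDeriv _) i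
  · exact fun i _ => integrable_cylMeasure
      (hA.continuous.mul ((hB.dirDeriv _).dirDeriv _).continuous)

lemma integral_mul_spaceLap_self (hU : SmoothPer U) :
    ∫ p, U p * spaceLap U p ∂cylMeasure d T = -gradSq T U := by
  simp only [integral_mul_spaceLap hU hU, gradSq, cylSq, ← pow_two]

lemma integral_timeDeriv_mul_spaceLap (hT : 0 ≤ T) (hU : SmoothPer U) :
    ∫ p, dirDeriv (timeDir d) U p * spaceLap U p ∂cylMeasure d T
      = -∑ i, ((∫ x in unitCube d, dirDeriv (spaceDir i) U (x, T) ^ 2)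
          - ∫ x in unitCube d, dirDeriv (spaceDir i) U (x, 0) ^ 2) / 2 := by
  rw [integral_mul_spaceLap (hU.dirDeriv _) hU]
  congr 1
  refine Finset.sum_congr rfl fun i _ => ?_
  rw [← integral_mul_timeDeriv_self hT (hU.dirDeriv _), dirDeriv_comm hU.smooth]
  simp only [mul_comm]

lemma sum_cylSq_second_spaceDeriv (hU : SmoothPer U) :
    ∑ i, ∑ k, cylSq T (dirDeriv (spaceDir i) (dirDeriv (spaceDir k) U)) = cylSq T (spaceLap U) := by
  have key : ∀ i k, cylSq T (dirDeriv (spaceDir i) (dirDeriv (spaceDir k) U))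
      = ∫ p, dirDeriv (spaceDir i) (dirDeriv (spaceDir i) U) p
          * dirDeriv (spaceDir k) (dirDeriv (spaceDir k) U) p ∂cylMeasure d T := by
    intro i k
    have hk := hU.dirDeriv (spaceDir k)
    have hi := hU.dirDeriv (spaceDir i)
    simp only [cylSq, pow_two]
    rw [integral_mul_spaceDeriv (hk.dirDeriv _) hk,
      integral_mul_spaceDeriv (hi.dirDeriv _) hk]
    congr 3
    rw [dirDeriv_comm hU.smooth (spaceDir i) (spaceDir k),
      dirDeriv_comm hi.smooth (spaceDir i) (spaceDir k)]
  simp only [key]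
  simp only [cylSq, spaceLap, pow_two, Finset.sum_mul_sum]
  have hc : ∀ i k, Continuous fun p => dirDeriv (spaceDir i) (dirDeriv (spaceDir i) U) p
          * dirDeriv (spaceDir k) (dirDeriv (spaceDir k) U) p := fun i k =>
    ((hU.dirDeriv _).dirDeriv _).continuous.mul ((hU.dirDeriv _).dirDeriv _).continuous
  rw [integral_finsetSum]
  · refine Finset.sum_congr rfl fun i _ => ?_
    rw [integral_finsetSum]
    exact fun k _ => integrable_cylMeasure (hc i k)
  · exact fun i _ => integrable_cylMeasure (continuous_finsetSum _ fun k _ => hc i k)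

end Integration

section Energy

variable {d : ℕ} {T θ δ m M : ℝ} {f : (Fin d → ℝ) → ℝ} {U W : (Fin d → ℝ) × ℝ → ℝ}

lemma cylSq_listDeriv_le (hU : SmoothPer U) {L : List (Fin d)} (hL : L.length ≤ 2) :
    cylSq T (listDeriv L U) ≤ cylSq T U + gradSq T U + cylSq T (spaceLap U) := by
  have h0 := cylSq_nonneg T U
  have h1 := gradSq_nonneg T U
  have h2 := cylSq_nonneg T (spaceLap U)
  match L, hL with
  | [], _ =>
    change cylSq T U ≤ _
    linarith
  | [i], _ =>
    have h : cylSq T (dirDeriv (spaceDir i) U) ≤ gradSq T U :=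
      Finset.single_le_sum (f := fun i => cylSq T (dirDeriv (spaceDir i) U))
        (fun _ _ => cylSq_nonneg T _) (Finset.mem_univ i)
    change cylSq T (dirDeriv (spaceDir i) U) ≤ _
    linarith
  | [i, k], _ =>
    change cylSq T (dirDeriv (spaceDir i) (dirDeriv (spaceDir k) U)) ≤ _
    have h : cylSq T (dirDeriv (spaceDir i) (dirDeriv (spaceDir k) U)) ≤ cylSq T (spaceLap U) := by
      rw [← sum_cylSq_second_spaceDeriv hU]
      refine (Finset.single_le_sum
        (f := fun k => cylSq T (dirDeriv (spaceDir i) (dirDeriv (spaceDir k) U)))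
        (fun _ _ => cylSq_nonneg T _) (Finset.mem_univ k)).trans ?_
      exact Finset.single_le_sum
        (f := fun i => ∑ k, cylSq T (dirDeriv (spaceDir i) (dirDeriv (spaceDir k) U)))
        (fun _ _ => Finset.sum_nonneg fun _ _ => cylSq_nonneg T _) (Finset.mem_univ i)
    linarith
  | _ :: _ :: _ :: _, hL => simp at hL

lemma h21Sq_le (hU : SmoothPer U) :
    h21Sq T (fun x t => U (x, t))
      ≤ ((Finset.univ.filter fun j : Fin d → Fin 3 => (∑ i, (j i : ℕ)) ≤ 2).card : ℝ)
          * (cylSq T U + gradSq T U + cylSq T (spaceLap U))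
        + (cylSq T U + cylSq T (dirDeriv (timeDir d) U)) := by
  unfold h21Sq
  refine add_le_add ?_ (le_of_eq ?_)
  · choose L hLlen hL using fun j : Fin d → ℕ => exists_mder_eq_foldr j
    simp only [hL, foldr_pder_slice hU.smooth]
    have hc : ∀ L : List (Fin d), Continuous fun p => listDeriv L U p ^ 2 := fun L =>
      (contDiff_listDeriv hU.smooth L).continuous.pow 2
    rw [integral_finsetSum _ fun j _ => integrableOn_integral_unitCube (hc _), ← nsmul_eq_mul]
    refine Finset.sum_le_card_nsmul _ _ _ fun j hj => ?_
    rw [← integral_cylMeasure_symm (hc (L fun i => (j i : ℕ)))]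
    refine cylSq_listDeriv_le hU ?_
    rw [hLlen]
    exact (Finset.mem_filter.1 hj).2
  · simp only [(hasDerivAt_time_slice hU.smooth _ _).deriv]
    have hc1 : Continuous fun p => U p ^ 2 := hU.continuous.pow 2
    have hc2 : Continuous fun p => dirDeriv (timeDir d) U p ^ 2 := (hU.dirDeriv _).continuous.pow 2
    rw [cylSq, cylSq, ← integral_add (integrable_cylMeasure hc1) (integrable_cylMeasure hc2),
      integral_cylMeasure (g := fun p => U p ^ 2 + dirDeriv (timeDir d) U p ^ 2) (hc1.add hc2)]

lemma cylSq_timeDeriv_add_cylSq_spaceLap_le (hT : 0 ≤ T) (hθ : 0 ≤ θ) (hU : SmoothPer U) :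
    cylSq T (dirDeriv (timeDir d) U) + θ ^ 2 / 4 * cylSq T (spaceLap U)
      ≤ cylSq T (fun p => dirDeriv (timeDir d) U p - θ / 2 * spaceLap U p)
        + θ / 2 * ∑ i, ∫ x in unitCube d, dirDeriv (spaceDir i) U (x, 0) ^ 2 := by
  have ct := (hU.dirDeriv (timeDir d)).continuous
  have cl := hU.continuous_spaceLap
  have e : cylSq T (fun p => dirDeriv (timeDir d) U p - θ / 2 * spaceLap U p)
      = cylSq T (dirDeriv (timeDir d) U) + θ ^ 2 / 4 * cylSq T (spaceLap U)
        - θ * ∫ p, dirDeriv (timeDir d) U p * spaceLap U p ∂cylMeasure d T := by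
    simp only [cylSq]
    rw [← integral_const_mul, ← integral_const_mul, ← integral_add, ← integral_sub]
    · exact integral_congr_ae (Eventually.of_forall fun p => by simp only; ring)
    all_goals exact integrable_cylMeasure (by fun_prop)
  have h : -∫ p, dirDeriv (timeDir d) U p * spaceLap U p ∂cylMeasure d T
      ≥ -((∑ i, ∫ x in unitCube d, dirDeriv (spaceDir i) U (x, 0) ^ 2) / 2) := by
    rw [integral_timeDeriv_mul_spaceLap hT hU, neg_neg, Finset.sum_div, ← Finset.sum_neg_distrib]
    refine Finset.sum_le_sum fun i _ => ?_
    have : 0 ≤ ∫ x in unitCube d, dirDeriv (spaceDir i) U (x, T) ^ 2 :=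
      integral_nonneg fun _ => sq_nonneg _
    linarith
  rw [e]
  nlinarith [mul_le_mul_of_nonneg_left h.le hθ]

lemma gradSq_add_cylSq_le_of_heat (hT : 0 ≤ T) (hm : ∀ x, m ≤ f x)
    (hU : SmoothPer U)
    (heq : ∀ x, ∀ t ∈ Set.Ioc (0 : ℝ) T,
      dirDeriv (timeDir d) U (x, t) = θ / 2 * spaceLap U (x, t) - f x * U (x, t)) :
    θ / 2 * gradSq T U + m * cylSq T U ≤ (∫ x in unitCube d, U (x, 0) ^ 2) / 2 := by
  have cu := hU.continuous
  have cl := hU.continuous_spaceLap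
  have h1 := integral_mul_timeDeriv_self hT hU
  have h2 := integral_mul_spaceLap_self (T := T) hU
  have h3 : 0 ≤ ∫ x in unitCube d, U (x, T) ^ 2 := integral_nonneg fun _ => sq_nonneg _
  have h4 : ∫ p, U p * dirDeriv (timeDir d) U p ∂cylMeasure d T
      ≤ θ / 2 * (∫ p, U p * spaceLap U p ∂cylMeasure d T) - m * cylSq T U := by
    rw [cylSq, ← integral_const_mul, ← integral_const_mul, ← integral_sub]
    · refine integral_mono_ae (integrable_cylMeasure (cu.mul (hU.dirDeriv _).continuous))
        (integrable_cylMeasure (by fun_prop)) (ae_cylMeasure fun x t ht => ?_)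
      simp only [heq x t ht]
      nlinarith [mul_le_mul_of_nonneg_right (hm x) (sq_nonneg (U (x, t)))]
    all_goals exact integrable_cylMeasure (by fun_prop)
  rw [h2, h1] at h4
  linarith

lemma cylSq_spaceLap_le_of_heat (hT : 0 ≤ T) (hθ : 0 ≤ θ)
    (hM : ∀ x, |f x| ≤ M) (hU : SmoothPer U)
    (heq : ∀ x, ∀ t ∈ Set.Ioc (0 : ℝ) T,
      dirDeriv (timeDir d) U (x, t) = θ / 2 * spaceLap U (x, t) - f x * U (x, t)) :
    θ ^ 2 / 4 * cylSq T (spaceLap U) ≤ M ^ 2 * cylSq T U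
      + θ / 2 * ∑ i, ∫ x in unitCube d, dirDeriv (spaceDir i) U (x, 0) ^ 2 := by
  have cu := hU.continuous
  have ct := (hU.dirDeriv (timeDir d)).continuous
  have cl := hU.continuous_spaceLap
  have h1 := cylSq_timeDeriv_add_cylSq_spaceLap_le hT hθ hU
  have h2 : cylSq T (fun p => dirDeriv (timeDir d) U p - θ / 2 * spaceLap U p)
      ≤ M ^ 2 * cylSq T U := by
    rw [cylSq, cylSq, ← integral_const_mul]
    refine integral_mono_ae (integrable_cylMeasure (by fun_prop))
        (integrable_cylMeasure (by fun_prop)) (ae_cylMeasure fun x t ht => ?_)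
    simp only [heq x t ht]
    have := mul_le_mul_of_nonneg_right (sq_le_sq' (abs_le.1 (hM x)).1 (abs_le.1 (hM x)).2)
      (sq_nonneg (U (x, t)))
    linarith
  linarith [cylSq_nonneg T (dirDeriv (timeDir d) U)]

lemma gradSq_add_cylSq_le_of_forced_heat (hT : 0 ≤ T) (hθ : 0 < θ)
    (hm : ∀ x, m ≤ f x) (hU : SmoothPer U) (hW : SmoothPer W) (hW0 : ∀ x, W (x, 0) = 0)
    (heq : ∀ x, ∀ t ∈ Set.Ioc (0 : ℝ) T, dirDeriv (timeDir d) W (x, t)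
      = θ / 2 * spaceLap W (x, t) - f x * W (x, t) + δ / 2 * spaceLap U (x, t)) :
    θ / 4 * gradSq T W + m * cylSq T W ≤ δ ^ 2 / (4 * θ) * gradSq T U := by
  have cw := hW.continuous
  have clw := hW.continuous_spaceLap
  have clu := hU.continuous_spaceLap
  have h1 := integral_mul_timeDeriv_self hT hW
  have h2 := integral_mul_spaceLap_self (T := T) hW
  have h3 : 0 ≤ ∫ x in unitCube d, W (x, T) ^ 2 := integral_nonneg fun _ => sq_nonneg _
  have h4 : ∫ p, W p * dirDeriv (timeDir d) W p ∂cylMeasure d T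
      ≤ θ / 2 * (∫ p, W p * spaceLap W p ∂cylMeasure d T) - m * cylSq T W
        + δ / 2 * ∫ p, W p * spaceLap U p ∂cylMeasure d T := by
    rw [cylSq, ← integral_const_mul, ← integral_const_mul, ← integral_const_mul, ← integral_sub,
      ← integral_add]
    · refine integral_mono_ae (integrable_cylMeasure (cw.mul (hW.dirDeriv _).continuous))
        (integrable_cylMeasure (by fun_prop)) (ae_cylMeasure fun x t ht => ?_)
      simp only [heq x t ht]
      nlinarith [mul_le_mul_of_nonneg_right (hm x) (sq_nonneg (W (x, t)))]
    all_goals exact integrable_cylMeasure (by fun_prop)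
  have h5 : δ / 2 * ∫ p, W p * spaceLap U p ∂cylMeasure d T
      ≤ θ / 4 * gradSq T W + δ ^ 2 / (4 * θ) * gradSq T U := by
    rw [integral_mul_spaceLap hW hU, gradSq, gradSq, Finset.mul_sum, Finset.mul_sum,
      ← Finset.sum_neg_distrib, Finset.mul_sum, ← Finset.sum_add_distrib]
    refine Finset.sum_le_sum fun i _ => ?_
    have ci := (hW.dirDeriv (spaceDir i)).continuous
    have ci' := (hU.dirDeriv (spaceDir i)).continuous
    rw [← integral_neg, cylSq, cylSq, ← integral_const_mul, ← integral_const_mul,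
      ← integral_const_mul, ← integral_add]
    · refine integral_mono (integrable_cylMeasure (by fun_prop))
        (integrable_cylMeasure (by fun_prop)) fun p => ?_
      simp only
      generalize dirDeriv (spaceDir i) W p = a
      generalize dirDeriv (spaceDir i) U p = b
      have : θ / 4 * a ^ 2 + δ ^ 2 / (4 * θ) * b ^ 2 - δ / 2 * -(a * b)
          = (θ * a + δ * b) ^ 2 / (4 * θ) := by
        field_simp
        ring
      have : 0 ≤ (θ * a + δ * b) ^ 2 / (4 * θ) := by positivity
      linarith
    all_goals exact integrable_cylMeasure (by fun_prop)
  simp only [hW0] at h1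
  rw [h2, h1] at h4
  simp at h4
  linarith

lemma cylSq_add_cylSq_spaceLap_le_of_forced_heat (hT : 0 ≤ T) (hθ : 0 ≤ θ)
    (hM : ∀ x, |f x| ≤ M) (hU : SmoothPer U) (hW : SmoothPer W) (hW0 : ∀ x, W (x, 0) = 0)
    (heq : ∀ x, ∀ t ∈ Set.Ioc (0 : ℝ) T, dirDeriv (timeDir d) W (x, t)
      = θ / 2 * spaceLap W (x, t) - f x * W (x, t) + δ / 2 * spaceLap U (x, t)) :
    cylSq T (dirDeriv (timeDir d) W) + θ ^ 2 / 4 * cylSq T (spaceLap W)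
      ≤ 2 * M ^ 2 * cylSq T W + δ ^ 2 / 2 * cylSq T (spaceLap U) := by
  have cw := hW.continuous
  have ct := (hW.dirDeriv (timeDir d)).continuous
  have clw := hW.continuous_spaceLap
  have clu := hU.continuous_spaceLap
  have h1 := cylSq_timeDeriv_add_cylSq_spaceLap_le hT hθ hW
  have h0 : ∀ i x, dirDeriv (spaceDir i) W (x, 0) = 0 := by
    intro i x
    rw [← congrFun (pder_slice hW.smooth i 0) x]
    simp [hW0, pder]
  have h2 : cylSq T (fun p => dirDeriv (timeDir d) W p - θ / 2 * spaceLap W p)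
      ≤ 2 * M ^ 2 * cylSq T W + δ ^ 2 / 2 * cylSq T (spaceLap U) := by
    rw [cylSq, cylSq, cylSq, ← integral_const_mul, ← integral_const_mul, ← integral_add]
    · refine integral_mono_ae (integrable_cylMeasure (by fun_prop))
        (integrable_cylMeasure (by fun_prop)) (ae_cylMeasure fun x t ht => ?_)
      simp only [heq x t ht]
      have := mul_le_mul_of_nonneg_right (sq_le_sq' (abs_le.1 (hM x)).1 (abs_le.1 (hM x)).2)
        (sq_nonneg (W (x, t)))
      nlinarith [sq_nonneg (f x * W (x, t) + δ / 2 * spaceLap U (x, t))]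
    all_goals exact integrable_cylMeasure (by fun_prop)
  simp only [h0] at h1
  simp at h1
  linarith

end Energy

lemma LinkFun.exists_le_mul_one_add_abs (Φ : LinkFun) :
    ∃ K, 0 < K ∧ ∀ y, |Φ.toFun y| ≤ K * (1 + |y|) := by
  obtain ⟨C, hC⟩ := Φ.derivs_bdd 1 le_rfl
  simp only [iteratedDeriv_one] at hC
  have h0 : 0 < Φ.toFun 0 := Φ.fmin_pos.trans (Φ.gt_fmin 0)
  have hC0 : 0 ≤ C := (abs_nonneg _).trans (hC 0)
  refine ⟨Φ.toFun 0 + C, by positivity, fun y => ?_⟩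
  have h := Convex.norm_image_sub_le_of_norm_deriv_le (f := Φ.toFun) (x := 0) (y := y)
    (fun x _ => Φ.smooth.differentiable (by simp) x) (fun x _ => hC x) convex_univ
    (Set.mem_univ _) (Set.mem_univ _)
  simp only [Real.norm_eq_abs, sub_zero] at h
  have h1 := abs_add_le (Φ.toFun y - Φ.toFun 0) (Φ.toFun 0)
  rw [sub_add_cancel, abs_of_pos h0] at h1
  nlinarith [abs_nonneg y]

/-- The constant that results from chaining the energy estimates of the heat equation and of the
forced heat equation. -/
lemma exists_const_of_energy_estimates {θmin θmax m A0 A1 N : ℝ} (hθmin : 0 < θmin)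
    (hθ : θmin ≤ θmax) (hm : 0 < m) (K : ℝ) (hA0n : 0 ≤ A0) (hA1n : 0 ≤ A1) (hNn : 0 ≤ N) :
    ∃ D > (0 : ℝ), ∀ θ ∈ Set.Icc θmin θmax, ∀ θ₀ ∈ Set.Icc θmin θmax,
      ∀ δ R GU XU LU GW XW LW TW H : ℝ, 1 ≤ R →
        0 ≤ GU → 0 ≤ XU → 0 ≤ LU → 0 ≤ GW → 0 ≤ XW → 0 ≤ LW → 0 ≤ TW →
        θ₀ / 2 * GU + m * XU ≤ A0 / 2 →
        θ₀ ^ 2 / 4 * LU ≤ (K * R) ^ 2 * XU + θ₀ / 2 * A1 →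
        θ / 4 * GW + m * XW ≤ δ ^ 2 / (4 * θ) * GU →
        TW + θ ^ 2 / 4 * LW ≤ 2 * (K * R) ^ 2 * XW + δ ^ 2 / 2 * LU →
        H ≤ N * (XW + GW + LW) + (XW + TW) →
        H ≤ (D * |δ| * R) ^ 2 := by
  have hθmax : 0 < θmax := hθmin.trans_le hθ
  obtain ⟨C1, hC1⟩ : ∃ C, C = (K ^ 2 * (A0 / (2 * m)) + θmax / 2 * A1) * (4 / θmin ^ 2) :=
    ⟨_, rfl⟩
  obtain ⟨C2, hC2⟩ : ∃ C, C = A0 / (4 * θmin ^ 2 * m) := ⟨_, rfl⟩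
  obtain ⟨C3, hC3⟩ : ∃ C, C = A0 / θmin ^ 3 := ⟨_, rfl⟩
  obtain ⟨C4, hC4⟩ : ∃ C, C = 2 * K ^ 2 * C2 + C1 / 2 := ⟨_, rfl⟩
  have hC1n : 0 ≤ C1 := by rw [hC1]; positivity
  have hC2n : 0 ≤ C2 := by rw [hC2]; positivity
  have hC3n : 0 ≤ C3 := by rw [hC3]; positivity
  have hC4n : 0 ≤ C4 := by rw [hC4]; positivity
  obtain ⟨C5, hC5⟩ : ∃ C, C = N * (C2 + C3 + C4 * (4 / θmin ^ 2)) + (C2 + C4) := ⟨_, rfl⟩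
  have hC5n : 0 ≤ C5 := by rw [hC5]; positivity
  refine ⟨C5 + 1, by positivity, ?_⟩
  rintro θ ⟨hθ1, hθ2⟩ θ₀ ⟨hθ₀1, hθ₀2⟩ δ R GU XU LU GW XW LW TW H hR1
    n1 n2 n3 n4 n5 n6 n7 b1 b2 b3 b4 b5
  have hθpos : 0 < θ := hθmin.trans_le hθ1
  have hθ₀pos : 0 < θ₀ := hθmin.trans_le hθ₀1
  have c1 : GU ≤ A0 / θmin := by
    rw [le_div_iff₀ hθmin]
    linarith [mul_le_mul_of_nonneg_right hθ₀1 n1, mul_nonneg hm.le n2]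
  have c2 : XU ≤ A0 / (2 * m) := by
    rw [le_div_iff₀ (by positivity)]
    linarith [mul_nonneg hθ₀pos.le n1]
  have hR2 : 1 ≤ R ^ 2 := one_le_pow₀ hR1
  have c3 : LU ≤ R ^ 2 * C1 := by
    have e1 : θmin ^ 2 / 4 * LU ≤ θ₀ ^ 2 / 4 * LU := by gcongr
    have e2 : (K * R) ^ 2 * XU ≤ (K * R) ^ 2 * (A0 / (2 * m)) := by gcongr
    have e3 : θ₀ / 2 * A1 ≤ R ^ 2 * (θmax / 2 * A1) := by
      have : θ₀ / 2 * A1 ≤ θmax / 2 * A1 := by gcongr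
      exact this.trans (le_mul_of_one_le_left (by positivity) hR2)
    have e4 : θmin ^ 2 / 4 * LU ≤ R ^ 2 * (K ^ 2 * (A0 / (2 * m)) + θmax / 2 * A1) := by
      linarith
    have e5 : LU = θmin ^ 2 / 4 * LU * (4 / θmin ^ 2) := by field_simp
    rw [e5, hC1, ← mul_assoc]
    gcongr
  have c4 : θ / 4 * GW + m * XW ≤ δ ^ 2 * (A0 / (4 * θmin ^ 2)) := by
    refine b3.trans ?_
    calc δ ^ 2 / (4 * θ) * GU ≤ δ ^ 2 / (4 * θmin) * (A0 / θmin) := by gcongr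
      _ = _ := by field_simp
  have c5 : XW ≤ δ ^ 2 * C2 := by
    have e : δ ^ 2 * C2 = δ ^ 2 * (A0 / (4 * θmin ^ 2)) / m := by rw [hC2]; field_simp
    rw [e, le_div_iff₀ hm]
    linarith [mul_nonneg hθpos.le n4]
  have c6 : GW ≤ δ ^ 2 * C3 := by
    have e : δ ^ 2 * C3 = δ ^ 2 * (A0 / (4 * θmin ^ 2)) / (θmin / 4) := by rw [hC3]; field_simp
    rw [e, le_div_iff₀ (by positivity)]
    linarith [mul_nonneg hm.le n5, mul_le_mul_of_nonneg_right hθ1 n4]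
  have c7 : TW + θmin ^ 2 / 4 * LW ≤ (δ * R) ^ 2 * C4 := by
    have e1 : θmin ^ 2 / 4 * LW ≤ θ ^ 2 / 4 * LW := by gcongr
    have e2 : 2 * (K * R) ^ 2 * XW ≤ 2 * (K * R) ^ 2 * (δ ^ 2 * C2) := by gcongr
    have e3 : δ ^ 2 / 2 * LU ≤ δ ^ 2 / 2 * (R ^ 2 * C1) := by gcongr
    rw [hC4]
    linarith
  have c8 : TW ≤ (δ * R) ^ 2 * C4 := by
    have : 0 ≤ θmin ^ 2 / 4 * LW := by positivity
    linarith
  have c9 : LW ≤ (δ * R) ^ 2 * (C4 * (4 / θmin ^ 2)) := by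
    have e : LW = θmin ^ 2 / 4 * LW * (4 / θmin ^ 2) := by field_simp
    rw [e, ← mul_assoc]
    exact mul_le_mul_of_nonneg_right (by linarith) (by positivity)
  have hδR : δ ^ 2 ≤ (δ * R) ^ 2 := by
    rw [mul_pow]
    exact le_mul_of_one_le_right (sq_nonneg _) hR2
  have c10 : XW ≤ (δ * R) ^ 2 * C2 := c5.trans (by gcongr)
  have c11 : GW ≤ (δ * R) ^ 2 * C3 := c6.trans (by gcongr)
  have c12 : H ≤ (δ * R) ^ 2 * C5 := by
    refine b5.trans ?_
    have : N * (XW + GW + LW) ≤ N * ((δ * R) ^ 2 * C2 + (δ * R) ^ 2 * C3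
      + (δ * R) ^ 2 * (C4 * (4 / θmin ^ 2))) := by gcongr
    rw [hC5]
    linarith
  have e1 : C5 ≤ (C5 + 1) ^ 2 := by
    rw [add_sq]
    linarith [sq_nonneg C5]
  calc H ≤ (δ * R) ^ 2 * C5 := c12
    _ ≤ (δ * R) ^ 2 * (C5 + 1) ^ 2 := by gcongr
    _ = ((C5 + 1) * |δ| * R) ^ 2 := by
        simp only [mul_pow, sq_abs]
        ring

/-- Lipschitz continuity of the forward map in the diffusivity `θ`
(Lemma `bounds`, item (iii)). -/
theorem forward_map_lipschitz_in_theta {d : ℕ} (hd : 1 ≤ d) (T θmin θmax : ℝ)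
    (hT : 0 < T) (hθmin : 0 < θmin) (hθ : θmin ≤ θmax) (Φ : LinkFun)
    (u0 : (Fin d → ℝ) → ℝ) (hu0 : ContDiff ℝ (⊤ : ℕ∞) u0) (hu0per : ZPer u0) :
    ∃ D > (0 : ℝ), ∀ θ ∈ Set.Icc θmin θmax, ∀ θ₀ ∈ Set.Icc θmin θmax,
      ∀ F : (Fin d → ℝ) → ℝ, Continuous F → ZPer F → (∃ M, ∀ x, |F x| ≤ M) →
      ∀ u u₀ : (Fin d → ℝ) → ℝ → ℝ,
        HeatSol T θ (fun x => Φ.toFun (F x)) u0 u →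
        HeatSol T θ₀ (fun x => Φ.toFun (F x)) u0 u₀ →
        h21 T (fun x t => u x t - u₀ x t)
          ≤ D * |θ - θ₀| * (1 + l2T F) * (1 + supT F) := by
  obtain ⟨K, hK, hΦ⟩ := Φ.exists_le_mul_one_add_abs
  have hm := Φ.fmin_pos
  set m := Φ.fmin
  obtain ⟨A0, hA0⟩ : ∃ A0, A0 = ∫ x in unitCube d, u0 x ^ 2 := ⟨_, rfl⟩
  obtain ⟨A1, hA1⟩ : ∃ A1, A1 = ∑ i, ∫ x in unitCube d, pder i u0 x ^ 2 := ⟨_, rfl⟩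
  have hA0n : 0 ≤ A0 := hA0 ▸ integral_nonneg fun _ => sq_nonneg _
  have hA1n : 0 ≤ A1 := hA1 ▸ Finset.sum_nonneg fun _ _ => integral_nonneg fun _ => sq_nonneg _
  obtain ⟨N, hN⟩ : ∃ N : ℝ, N =
    ((Finset.univ.filter fun j : Fin d → Fin 3 => (∑ i, (j i : ℕ)) ≤ 2).card : ℝ) := ⟨_, rfl⟩
  have hNn : 0 ≤ N := hN ▸ Nat.cast_nonneg _
  obtain ⟨D, hD, key⟩ := exists_const_of_energy_estimates hθmin hθ hm K hA0n hA1n hNn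
  refine ⟨D, hD, ?_⟩
  rintro θ ⟨hθ1, hθ2⟩ θ₀ ⟨hθ₀1, hθ₀2⟩ F - - ⟨B, hB⟩ u u₀
    ⟨hus, hup, hueq, hu0'⟩ ⟨hu₀s, hu₀p, hu₀eq, hu₀0⟩
  have hθpos : 0 < θ := hθmin.trans_le hθ1
  have hθ₀pos : 0 < θ₀ := hθmin.trans_le hθ₀1
  obtain ⟨R, hR⟩ : ∃ R, R = 1 + supT F := ⟨_, rfl⟩
  have hFsup : ∀ x, |F x| ≤ supT F :=
    le_ciSup (f := fun x => |F x|) ⟨B, by rintro _ ⟨x, rfl⟩; exact hB x⟩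
  have hR1 : 1 ≤ R := by
    rw [hR]
    linarith [(abs_nonneg _).trans (hFsup 0)]
  have hfM : ∀ x, |Φ.toFun (F x)| ≤ K * R := fun x =>
    (hΦ _).trans (mul_le_mul_of_nonneg_left (by rw [hR]; linarith [hFsup x]) hK.le)
  have hfm : ∀ x, m ≤ Φ.toFun (F x) := fun x => (Φ.gt_fmin _).le
  obtain ⟨V, hV⟩ : ∃ V : (Fin d → ℝ) × ℝ → ℝ, V = fun p => u p.1 p.2 := ⟨_, rfl⟩
  obtain ⟨U, hU⟩ : ∃ U : (Fin d → ℝ) × ℝ → ℝ, U = fun p => u₀ p.1 p.2 := ⟨_, rfl⟩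
  have sV : SmoothPer V := by subst hV; exact ⟨hus, fun x t k => hup t x k⟩
  have sU : SmoothPer U := by subst hU; exact ⟨hu₀s, fun x t k => hu₀p t x k⟩
  have eV : ∀ x, ∀ t ∈ Set.Ioc (0 : ℝ) T, dirDeriv (timeDir d) V (x, t)
      = θ / 2 * spaceLap V (x, t) - Φ.toFun (F x) * V (x, t) := by
    intro x t ht
    rw [← (hasDerivAt_time_slice sV.smooth x t).deriv, ← congrFun (lap_slice sV.smooth t) x]
    subst hV
    exact hueq x t ht
  have eU : ∀ x, ∀ t ∈ Set.Ioc (0 : ℝ) T, dirDeriv (timeDir d) U (x, t)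
      = θ₀ / 2 * spaceLap U (x, t) - Φ.toFun (F x) * U (x, t) := by
    intro x t ht
    rw [← (hasDerivAt_time_slice sU.smooth x t).deriv, ← congrFun (lap_slice sU.smooth t) x]
    subst hU
    exact hu₀eq x t ht
  have hUini : ∀ x, U (x, 0) = u0 x := fun x => by subst hU; exact hu₀0 x
  have hVini : ∀ x, V (x, 0) = u0 x := fun x => by subst hV; exact hu0' x
  have hdUini : ∀ i x, dirDeriv (spaceDir i) U (x, 0) = pder i u0 x := by
    intro i x
    rw [← congrFun (pder_slice sU.smooth i 0) x]
    simp only [hUini]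
  have hgoal : (fun x t => u x t - u₀ x t) = fun x t => (fun p => V p - U p) (x, t) := by
    subst hU hV
    rfl
  have sW := sV.sub sU
  obtain ⟨W, hW⟩ : ∃ W : (Fin d → ℝ) × ℝ → ℝ, W = fun p => V p - U p := ⟨_, rfl⟩
  obtain ⟨δ, hδ⟩ : ∃ δ, δ = θ - θ₀ := ⟨_, rfl⟩
  have eW : ∀ x, ∀ t ∈ Set.Ioc (0 : ℝ) T, dirDeriv (timeDir d) W (x, t)
      = θ / 2 * spaceLap W (x, t) - Φ.toFun (F x) * W (x, t) + δ / 2 * spaceLap U (x, t) := by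
    intro x t ht
    simp only [hW, dirDeriv_sub sV.smooth sU.smooth, spaceLap_sub sV sU]
    rw [eV x t ht, eU x t ht, hδ]
    ring
  have hWini : ∀ x, W (x, 0) = 0 := fun x => by rw [hW]; simp [hUini, hVini]
  rw [hgoal, ← hδ, ← hR]
  rw [← hW] at sW ⊢
  have b1 := gradSq_add_cylSq_le_of_heat hT.le hfm sU eU
  have b2 := cylSq_spaceLap_le_of_heat hT.le hθ₀pos.le hfM sU eU
  have b3 := gradSq_add_cylSq_le_of_forced_heat hT.le hθpos hfm sU sW hWini eW
  have b4 := cylSq_add_cylSq_spaceLap_le_of_forced_heat hT.le hθpos.le hfM sU sW hWini eW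
  have b5 := h21Sq_le (T := T) sW
  simp only [hdUini, hUini] at b1 b2
  rw [← hA0] at b1
  rw [← hA1] at b2
  rw [← hN] at b5
  have n1 := gradSq_nonneg T U
  have n2 := cylSq_nonneg T U
  have n3 := cylSq_nonneg T (spaceLap U)
  have n4 := gradSq_nonneg T W
  have n5 := cylSq_nonneg T W
  have n6 := cylSq_nonneg T (spaceLap W)
  have n7 := cylSq_nonneg T (dirDeriv (timeDir d) W)
  have hl : 0 ≤ l2T F := Real.sqrt_nonneg _
  have e1 : 1 ≤ (1 + l2T F) ^ 2 := one_le_pow₀ (by linarith)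
  refine Real.sqrt_le_iff.2 ⟨by positivity,
    (key θ ⟨hθ1, hθ2⟩ θ₀ ⟨hθ₀1, hθ₀2⟩ δ R _ _ _ _ _ _ _ _ hR1
      n1 n2 n3 n4 n5 n6 n7 b1 b2 b3 b4 b5).trans ?_⟩
  calc (D * |δ| * R) ^ 2 ≤ (D * |δ| * R) ^ 2 * (1 + l2T F) ^ 2 :=
        le_mul_of_one_le_right (sq_nonneg _) e1
    _ = (D * |δ| * (1 + l2T F) * R) ^ 2 := by ring
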